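/- arXiv:2303.15733 — 2 statements merged into one kernel-verified Lean document; each statement's English description precedes it below -/
import Mathlib

section
/- Let M be a real symmetric 3×3 matrix such that G := tr(M)·I − M is positive definite. For X ∈ SO(3), the matrix MX is symmetric (equivalently, the antisymmetric projection P_a(MX) := (MX − (MX)ᵀ)/2 vanishes) if and only if X = I or X = R_a(π, v) for some unit vector v ∈ ℝ³ that is an eigenvector of M. (That is, the critical points of the modified trace function Ψ_M on SO(3) are exactly {I} ∪ R_a(π, E(M)), where E(M) is the set of unit eigenvectors of M.) -/
open Matrix Real

noncomputable section

/-- The special orthogonal group SO(3) as a set of real 3×3 matrices. -/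
def SO3 : Set (Matrix (Fin 3) (Fin 3) ℝ) := {R | Rᵀ * R = 1 ∧ R.det = 1}

/-- The hat map: u^∧ y = u × y. -/
def hat (u : Fin 3 → ℝ) : Matrix (Fin 3) (Fin 3) ℝ :=
  !![0, -u 2, u 1; u 2, 0, -u 0; -u 1, u 0, 0]

/-- The Rodrigues rotation R_a(θ, u) = I + sin θ · u^∧ + (1 − cos θ)·(u^∧)². -/
def Ra (θ : ℝ) (u : Fin 3 → ℝ) : Matrix (Fin 3) (Fin 3) ℝ :=
  1 + Real.sin θ • hat u + (1 - Real.cos θ) • (hat u * hat u)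

/-- The Cayley–Hamilton theorem for 3×3 matrices, solved for the adjugate. -/
theorem adjugate_eq_sq_sub_trace_smul (A : Matrix (Fin 3) (Fin 3) ℝ) :
    A.adjugate = A * A - A.trace • A + A.adjugate.trace • 1 := by
  ext i j
  fin_cases i <;> fin_cases j <;>
    simp [adjugate_fin_three, trace_fin_three, Matrix.mul_apply, Fin.sum_univ_three] <;> ring

theorem adjugate_add_one (A : Matrix (Fin 3) (Fin 3) ℝ) :
    (A + 1).adjugate = A.adjugate - A + (1 + A.trace) • 1 := by
  ext i j
  fin_cases i <;> fin_cases j <;>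
    simp [adjugate_fin_three, trace_fin_three] <;> ring

theorem Ra_pi {v : Fin 3 → ℝ} (hv : v ⬝ᵥ v = 1) :
    Ra π v = (2 : ℝ) • vecMulVec v v - 1 := by
  simp only [dotProduct, Fin.sum_univ_three] at hv
  ext i j
  fin_cases i <;> fin_cases j <;>
    simp [Ra, hat, vecMulVec_apply] <;> linarith

theorem trace_mul_hat_sq (M : Matrix (Fin 3) (Fin 3) ℝ) (w : Fin 3 → ℝ) :
    (M * (hat w * hat w)).trace = -(w ⬝ᵥ ((M.trace • 1 - M) *ᵥ w)) := by
  simp [hat, trace_fin_three, Matrix.mul_apply, mulVec, dotProduct, Fin.sum_univ_three]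
  ring

theorem sub_transpose_eq_hat (X : Matrix (Fin 3) (Fin 3) ℝ) :
    X - Xᵀ = hat ![X 2 1 - X 1 2, X 0 2 - X 2 0, X 1 0 - X 0 1] := by
  ext i j
  fin_cases i <;> fin_cases j <;> simp [hat]

theorem hat_zero : hat 0 = 0 := by
  ext i j
  fin_cases i <;> fin_cases j <;> simp [hat]

/-- If `tr(M) I - M` is positive definite, a rotation `X` with `M X` symmetric is symmetric. -/
theorem isSymm_of_mul_isSymm {M X : Matrix (Fin 3) (Fin 3) ℝ} (hM : M.IsSymm)
    (hG : (M.trace • (1 : Matrix (Fin 3) (Fin 3) ℝ) - M).PosDef) (hX : Xᵀ * X = 1)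
    (h : (M * X)ᵀ = M * X) : Xᵀ = X := by
  have hX' : X * Xᵀ = 1 := mul_eq_one_comm.mp hX
  have hMX : Xᵀ * M = M * X := by rwa [transpose_mul, hM.eq] at h
  have h₁ : (M * (X * X)).trace = M.trace := by
    rw [← mul_assoc, ← hMX, mul_assoc, trace_mul_comm, mul_assoc, hX', mul_one]
  have h₂ : (M * (Xᵀ * Xᵀ)).trace = M.trace := by
    rw [← trace_transpose, transpose_mul, transpose_mul, transpose_transpose, hM.eq,
      trace_mul_comm, h₁]
  have hw := trace_mul_hat_sq M ![X 2 1 - X 1 2, X 0 2 - X 2 0, X 1 0 - X 0 1]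
  have hsq : (X - Xᵀ) * (X - Xᵀ) = X * X + Xᵀ * Xᵀ - 1 - 1 := by
    rw [sub_mul, mul_sub, mul_sub, hX, hX']
    abel
  rw [← sub_transpose_eq_hat, hsq] at hw
  simp only [mul_sub, mul_add, trace_sub, trace_add, h₁, h₂, mul_one] at hw
  have hw0 : ![X 2 1 - X 1 2, X 0 2 - X 2 0, X 1 0 - X 0 1] = 0 := by
    by_contra hne
    have hpos := hG.dotProduct_mulVec_pos hne
    rw [star_trivial] at hpos
    linarith
  have hhat := sub_transpose_eq_hat X
  rw [hw0, hat_zero] at hhat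
  exact (sub_eq_zero.mp hhat).symm

/-- A symmetric 3×3 matrix of positive trace with vanishing adjugate is of the form
`v vᵀ`. -/
theorem exists_eq_vecMulVec_of_adjugate_eq_zero {Q : Matrix (Fin 3) (Fin 3) ℝ} (hQ : Qᵀ = Q)
    (hadj : Q.adjugate = 0) (htr : 0 < Q.trace) : ∃ v, Q = vecMulVec v v := by
  have hs : ∀ i j, Q j i = Q i j := fun i j => congrFun (congrFun hQ i) j
  have hm : ∀ i j k, Q i j * Q i k = Q i i * Q j k := by
    have ha : ∀ i j, Q.adjugate i j = 0 := fun i j => by rw [hadj]; rfl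
    have h00 := ha 0 0
    have h01 := ha 0 1
    have h02 := ha 0 2
    have h11 := ha 1 1
    have h12 := ha 1 2
    have h22 := ha 2 2
    simp [adjugate_fin_three, hs 0 1, hs 0 2, hs 1 2] at h00 h01 h02 h11 h12 h22
    intro i j k
    fin_cases i <;> fin_cases j <;> fin_cases k <;>
      simp [hs 0 1, hs 0 2, hs 1 2] <;> linarith
  obtain ⟨i, -, hi⟩ : ∃ i ∈ Finset.univ, 0 < Q i i :=
    Finset.exists_lt_of_sum_lt (by simpa [trace] using htr)
  refine ⟨fun j => Q i j / √(Q i i), ?_⟩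
  ext j k
  rw [vecMulVec_apply, div_mul_div_comm, Real.mul_self_sqrt hi.le, hm i j k]
  field_simp

/-- A symmetric rotation other than the identity is a half-turn. -/
theorem exists_eq_Ra_pi {X : Matrix (Fin 3) (Fin 3) ℝ} (hX : X ∈ SO3) (hsymm : Xᵀ = X)
    (hne : X ≠ 1) : ∃ v : Fin 3 → ℝ, v ⬝ᵥ v = 1 ∧ X = Ra π v := by
  obtain ⟨hsq, hdet⟩ := hX
  rw [hsymm] at hsq
  have hadj : X.adjugate = X := by
    calc X.adjugate = X.adjugate * (X * X) := by rw [hsq, mul_one]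
      _ = X := by rw [← mul_assoc, adjugate_mul, hdet, one_smul, one_mul]
  have htr : 1 + X.trace = 0 := by
    have hch := adjugate_eq_sq_sub_trace_smul X
    rw [hadj, hsq] at hch
    have : (1 + X.trace) • (X - 1) = 0 := by
      have h0 := sub_eq_zero.mpr hch
      rw [← h0]
      module
    exact (smul_eq_zero.mp this).resolve_right (sub_ne_zero.mpr hne)
  have hadj1 : (X + 1).adjugate = 0 := by
    rw [adjugate_add_one, hadj, htr, zero_smul, sub_self, add_zero]
  have htr2 : (X + 1).trace = 2 := by
    simp only [trace_add, trace_one, Fintype.card_fin]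
    push_cast
    linarith
  obtain ⟨u, hu⟩ := exists_eq_vecMulVec_of_adjugate_eq_zero (Q := (2⁻¹ : ℝ) • (X + 1))
    (by simp [hsymm]) (by rw [adjugate_smul, hadj1, smul_zero]) (by rw [trace_smul, htr2]; norm_num)
  have hunit : u ⬝ᵥ u = 1 := by
    rw [← trace_vecMulVec, ← hu, trace_smul, htr2]
    norm_num
  refine ⟨u, hunit, ?_⟩
  rw [Ra_pi hunit, ← hu]
  module

/-- A matrix commuting with the half-turn about `v` has `v` as an eigenvector. -/
theorem exists_mulVec_eq_smul_of_commute_Ra_pi {M : Matrix (Fin 3) (Fin 3) ℝ} {v : Fin 3 → ℝ}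
    (hv : v ⬝ᵥ v = 1) (h : Commute M (Ra π v)) : ∃ μ : ℝ, M *ᵥ v = μ • v := by
  have hfix : Ra π v *ᵥ v = v := by
    rw [Ra_pi hv, sub_mulVec, smul_mulVec, vecMulVec_mulVec, hv]
    ext i
    simp
    ring
  have hMv : Ra π v *ᵥ (M *ᵥ v) = M *ᵥ v := by
    rw [mulVec_mulVec, ← h.eq, ← mulVec_mulVec, hfix]
  refine ⟨v ⬝ᵥ (M *ᵥ v), ?_⟩
  rw [Ra_pi hv, sub_mulVec, smul_mulVec, vecMulVec_mulVec] at hMv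
  ext i
  have := congrFun hMv i
  simp at this ⊢
  linarith

theorem mul_Ra_pi_isSymm {M : Matrix (Fin 3) (Fin 3) ℝ} (hM : M.IsSymm) {v : Fin 3 → ℝ}
    (hv : v ⬝ᵥ v = 1) {μ : ℝ} (h : M *ᵥ v = μ • v) : (M * Ra π v)ᵀ = M * Ra π v := by
  rw [Ra_pi hv, mul_sub, Matrix.mul_smul, mul_vecMulVec, h, mul_one, smul_vecMulVec, transpose_sub, hM.eq,
    transpose_smul, transpose_smul, transpose_vecMulVec]

/-- The critical points of the modified trace function Ψ_M on SO(3) are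
exactly {I} ∪ Rₐ(π, E(M)): for X ∈ SO(3), MX is symmetric iff X = I or
X = Rₐ(π, v) for some unit eigenvector v of M. -/
theorem critical_points_of_modified_trace
    (M : Matrix (Fin 3) (Fin 3) ℝ) (hM : M.IsSymm)
    (hG : (M.trace • (1 : Matrix (Fin 3) (Fin 3) ℝ) - M).PosDef) :
    ∀ X ∈ SO3, ((M * X)ᵀ = M * X ↔
      (X = 1 ∨ ∃ v : Fin 3 → ℝ, v ⬝ᵥ v = 1 ∧ (∃ μ : ℝ, M *ᵥ v = μ • v) ∧
        X = Ra π v)) := by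
  intro X hX
  constructor
  · intro h
    have hsymm := isSymm_of_mul_isSymm hM hG hX.1 h
    by_cases hne : X = 1
    · exact Or.inl hne
    · obtain ⟨v, hv, hXv⟩ := exists_eq_Ra_pi hX hsymm hne
      refine Or.inr ⟨v, hv, exists_mulVec_eq_smul_of_commute_Ra_pi hv ?_, hXv⟩
      rw [← hXv]
      rw [transpose_mul, hM.eq, hsymm] at h
      exact h.symm
  · rintro (rfl | ⟨v, hv, ⟨μ, hμ⟩, rfl⟩)
    · rw [mul_one, hM.eq]
    · exact mul_Ra_pi_isSymm hM hv hμ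

end
end

section
/- Let λ > 0 and M := λ·I (3×3 identity), let (v₁, v₂, v₃) be an orthonormal basis of ℝ³, and let the set of warping directions be U := {±v₁, ±v₂, ±v₃}. Then for every u_q ∈ U, every θ ∈ (0, π), and every unit vector v ∈ ℝ³, there exists u_p ∈ U with ⟨u_p, u_q⟩ = 0 such that tr(M(I − R_a(π,v)·R_a(θ,−u_q)·R_a(θ,u_p))) < tr(M(I − R_a(π,v))) = 4λ. -/
open Matrix Real

noncomputable section

/-- The homogeneous rotation matrix of the quaternion with real part `w` and imaginary part `x`. -/
def quatRot (w : ℝ) (x : Fin 3 → ℝ) : Matrix (Fin 3) (Fin 3) ℝ :=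
  (w ^ 2 - x ⬝ᵥ x) • 1 + (2 * w) • hat x + (2 : ℝ) • vecMulVec x x

theorem hat_mul_hat (u : Fin 3 → ℝ) : hat u * hat u = vecMulVec u u - (u ⬝ᵥ u) • 1 := by
  ext i j
  fin_cases i <;> fin_cases j <;>
    simp [hat, vecMulVec, dotProduct, Fin.sum_univ_three, Matrix.mul_apply] <;> ring

theorem Ra_eq_quatRot (θ : ℝ) {u : Fin 3 → ℝ} (hu : u ⬝ᵥ u = 1) :
    Ra θ u = quatRot (cos (θ / 2)) (sin (θ / 2) • u) := by
  have hs : sin θ = 2 * sin (θ / 2) * cos (θ / 2) := by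
    rw [← sin_two_mul, mul_div_cancel₀ θ two_ne_zero]
  have hc : cos θ = 1 - 2 * sin (θ / 2) ^ 2 := by
    rw [← cos_sq_add_sin_sq (θ / 2)]
    nth_rewrite 1 [← mul_div_cancel₀ θ (two_ne_zero (α := ℝ))]
    rw [cos_two_mul']
    ring
  have h1 : cos (θ / 2) ^ 2 = 1 - sin (θ / 2) ^ 2 := cos_sq' _
  have hhat : hat (sin (θ / 2) • u) = sin (θ / 2) • hat u := by
    ext i j
    fin_cases i <;> fin_cases j <;> simp [hat]
  rw [Ra, quatRot, hat_mul_hat, hhat]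
  simp only [smul_dotProduct, dotProduct_smul, hu, h1, hs, hc, smul_vecMulVec, vecMulVec_smul,
    smul_eq_mul]
  module

theorem trace_quatRot_mul_mul (w₁ w₂ w₃ : ℝ) (x₁ x₂ x₃ : Fin 3 → ℝ) :
    (quatRot w₁ x₁ * quatRot w₂ x₂ * quatRot w₃ x₃).trace =
      4 * (w₁ * (w₂ * w₃ - x₂ ⬝ᵥ x₃) -
          x₁ ⬝ᵥ (w₂ • x₃ + w₃ • x₂ + crossProduct x₂ x₃)) ^ 2 -
        (w₁ ^ 2 + x₁ ⬝ᵥ x₁) * (w₂ ^ 2 + x₂ ⬝ᵥ x₂) * (w₃ ^ 2 + x₃ ⬝ᵥ x₃) := by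
  simp [quatRot, hat, vecMulVec, dotProduct, Fin.sum_univ_three, Matrix.mul_apply, Matrix.trace,
    cross_apply]
  ring

theorem trace_Ra_pi {v : Fin 3 → ℝ} (hv : v ⬝ᵥ v = 1) : (Ra π v).trace = -1 := by
  simp only [dotProduct, Fin.sum_univ_three] at hv
  simp [Ra, hat, Fin.sum_univ_three, Matrix.trace]
  linear_combination -4 * hv

theorem trace_Ra_mul_mul (θ : ℝ) {p q v : Fin 3 → ℝ} (hp : p ⬝ᵥ p = 1) (hq : q ⬝ᵥ q = 1)
    (hv : v ⬝ᵥ v = 1) :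
    (Ra π v * Ra θ (-q) * Ra θ p).trace =
      4 * (sin (θ / 2) * (cos (θ / 2) * (p ⬝ᵥ v - q ⬝ᵥ v) -
        sin (θ / 2) * (v ⬝ᵥ crossProduct q p))) ^ 2 - 1 := by
  have hq' : -q ⬝ᵥ -q = 1 := by simpa using hq
  have h1 := cos_sq_add_sin_sq (θ / 2)
  rw [Ra_eq_quatRot π hv, Ra_eq_quatRot θ hq', Ra_eq_quatRot θ hp, trace_quatRot_mul_mul,
    dotProduct_comm p v, dotProduct_comm q v]
  simp only [smul_dotProduct, dotProduct_smul, dotProduct_add, neg_dotProduct, hp, hq, hv,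
    map_smul, map_neg, LinearMap.smul_apply, LinearMap.neg_apply, dotProduct_neg, cos_pi_div_two,
    sin_pi_div_two, smul_eq_mul]
  linear_combination (-(cos (θ / 2) ^ 2 + sin (θ / 2) ^ 2) - 1) * h1

theorem eq_sum_of_orthonormal {q a b : Fin 3 → ℝ}
    (hqq : q ⬝ᵥ q = 1) (haa : a ⬝ᵥ a = 1) (hbb : b ⬝ᵥ b = 1)
    (hqa : q ⬝ᵥ a = 0) (hqb : q ⬝ᵥ b = 0) (hab : a ⬝ᵥ b = 0) (v : Fin 3 → ℝ) :
    v = (q ⬝ᵥ v) • q + (a ⬝ᵥ v) • a + (b ⬝ᵥ v) • b := by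
  have hA : Matrix.of ![q, a, b] * (Matrix.of ![q, a, b])ᵀ = 1 := by
    ext i j
    change ![q, a, b] i ⬝ᵥ ![q, a, b] j = _
    fin_cases i <;> fin_cases j <;>
      simp [hqq, haa, hbb, hqa, hqb, hab, dotProduct_comm a q, dotProduct_comm b q,
        dotProduct_comm b a]
  have h : v = ((Matrix.of ![q, a, b])ᵀ * Matrix.of ![q, a, b]) *ᵥ v := by
    rw [mul_eq_one_comm.mp hA, one_mulVec]
  conv_lhs => rw [h, ← mulVec_mulVec]
  ext i
  simp [mulVec, dotProduct, Fin.sum_univ_three]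
  ring

/-- Among `±a, ±b`, some direction strictly increases the trace at a warped critical point. -/
theorem exists_neg_one_lt_trace {q a b v : Fin 3 → ℝ}
    (hqq : q ⬝ᵥ q = 1) (haa : a ⬝ᵥ a = 1) (hbb : b ⬝ᵥ b = 1)
    (hqa : q ⬝ᵥ a = 0) (hqb : q ⬝ᵥ b = 0) (hab : a ⬝ᵥ b = 0) (hv : v ⬝ᵥ v = 1)
    {θ : ℝ} (hθ : θ ∈ Set.Ioo 0 π) :
    ∃ p ∈ ({a, -a, b, -b} : Set (Fin 3 → ℝ)), p ⬝ᵥ q = 0 ∧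
      -1 < (Ra π v * Ra θ (-q) * Ra θ p).trace := by
  by_contra! H
  have hs : 0 < sin (θ / 2) :=
    sin_pos_of_pos_of_lt_pi (by linarith [hθ.1]) (by linarith [hθ.1, hθ.2])
  have hc : 0 < cos (θ / 2) :=
    cos_pos_of_mem_Ioo ⟨by linarith [hθ.1, pi_pos], by linarith [hθ.2]⟩
  have key : ∀ p ∈ ({a, -a, b, -b} : Set (Fin 3 → ℝ)), p ⬝ᵥ p = 1 → p ⬝ᵥ q = 0 →
      cos (θ / 2) * (p ⬝ᵥ v - q ⬝ᵥ v) - sin (θ / 2) * (v ⬝ᵥ crossProduct q p) = 0 := by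
    intro p hp hpp hpq
    have h := H p hp hpq
    rw [trace_Ra_mul_mul θ hpp hqq hv] at h
    have h0 := sq_nonpos_iff _ |>.mp (show (sin (θ / 2) * (cos (θ / 2) * (p ⬝ᵥ v - q ⬝ᵥ v) -
      sin (θ / 2) * (v ⬝ᵥ crossProduct q p))) ^ 2 ≤ 0 by linarith)
    exact (mul_eq_zero.mp h0).resolve_left hs.ne'
  rw [dotProduct_comm] at hqa hqb
  have ha := key a (by simp) haa hqa
  have ha' := key (-a) (by simp) (by simpa using haa) (by simpa using hqa)
  have hb := key b (by simp) hbb hqb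
  simp only [neg_dotProduct, map_neg, dotProduct_neg] at ha'
  have hqv : q ⬝ᵥ v = 0 := by
    have : cos (θ / 2) * (q ⬝ᵥ v) = 0 := by linarith
    exact (mul_eq_zero.mp this).resolve_left hc.ne'
  have hexp := eq_sum_of_orthonormal hqq haa hbb (by rwa [dotProduct_comm])
    (by rwa [dotProduct_comm]) hab v
  have hvv := congrArg (v ⬝ᵥ ·) hexp
  have hcross := congrArg (fun x => v ⬝ᵥ crossProduct q x) hexp
  simp only [dotProduct_add, dotProduct_smul, map_add, map_smul, hv, hqv, smul_eq_mul,
    zero_add, zero_smul, dotProduct_comm v a, dotProduct_comm v b, dot_cross_self] at hvv hcross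
  rw [hqv] at ha hb
  have : cos (θ / 2) = 0 := by
    linear_combination cos (θ / 2) * hvv + (a ⬝ᵥ v) * ha + (b ⬝ᵥ v) * hb - sin (θ / 2) * hcross
  exact hc.ne' this

/-- Synergy condition (Theorem 1, case 1): for M = λI and warping
directions U = {±v₁, ±v₂, ±v₃}, every warped unwanted critical point
admits an orthogonal warping direction strictly decreasing Ψ_M. -/
theorem synergy_case_identity_eigenvalues
    (lam : ℝ) (hlam : 0 < lam)
    (v₁ v₂ v₃ : Fin 3 → ℝ)
    (h11 : v₁ ⬝ᵥ v₁ = 1) (h22 : v₂ ⬝ᵥ v₂ = 1) (h33 : v₃ ⬝ᵥ v₃ = 1)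
    (h12 : v₁ ⬝ᵥ v₂ = 0) (h13 : v₁ ⬝ᵥ v₃ = 0) (h23 : v₂ ⬝ᵥ v₃ = 0)
    (M : Matrix (Fin 3) (Fin 3) ℝ)
    (hMdef : M = lam • (1 : Matrix (Fin 3) (Fin 3) ℝ))
    (U : Set (Fin 3 → ℝ)) (hU : U = {v₁, -v₁, v₂, -v₂, v₃, -v₃}) :
    ∀ uq ∈ U, ∀ θ ∈ Set.Ioo (0 : ℝ) π, ∀ v : Fin 3 → ℝ, v ⬝ᵥ v = 1 →
      ∃ up ∈ U, up ⬝ᵥ uq = 0 ∧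
        (M * (1 - Ra π v * Ra θ (-uq) * Ra θ up)).trace <
          (M * (1 - Ra π v)).trace ∧
        (M * (1 - Ra π v)).trace = 4 * lam := by
  subst hMdef hU
  intro uq huq θ hθ v hv
  suffices h : ∃ up ∈ ({v₁, -v₁, v₂, -v₂, v₃, -v₃} : Set (Fin 3 → ℝ)), up ⬝ᵥ uq = 0 ∧
      -1 < (Ra π v * Ra θ (-uq) * Ra θ up).trace by
    obtain ⟨up, hup, horth, hlt⟩ := h
    refine ⟨up, hup, horth, ?_, ?_⟩ <;>
      simp only [smul_mul, one_mul, trace_smul, trace_sub, trace_one, trace_Ra_pi hv,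
        Fintype.card_fin, smul_eq_mul]
    · gcongr
    · push_cast; ring
  have h21 := dotProduct_comm v₂ v₁ ▸ h12
  have h31 := dotProduct_comm v₃ v₁ ▸ h13
  have h32 := dotProduct_comm v₃ v₂ ▸ h23
  obtain ⟨a, b, haU, hbU, hqq, haa, hbb, hqa, hqb, hab⟩ : ∃ a b : Fin 3 → ℝ,
      (a = v₁ ∨ a = v₂ ∨ a = v₃) ∧ (b = v₁ ∨ b = v₂ ∨ b = v₃) ∧ uq ⬝ᵥ uq = 1 ∧
      a ⬝ᵥ a = 1 ∧ b ⬝ᵥ b = 1 ∧ uq ⬝ᵥ a = 0 ∧ uq ⬝ᵥ b = 0 ∧ a ⬝ᵥ b = 0 := by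
    rcases huq with rfl | rfl | rfl | rfl | rfl | rfl
    · exact ⟨v₂, v₃, by simp_all⟩
    · exact ⟨v₂, v₃, by simp_all⟩
    · exact ⟨v₁, v₃, by simp_all⟩
    · exact ⟨v₁, v₃, by simp_all⟩
    · exact ⟨v₁, v₂, by simp_all⟩
    · exact ⟨v₁, v₂, by simp_all⟩
  obtain ⟨p, hp, hpq⟩ := exists_neg_one_lt_trace hqq haa hbb hqa hqb hab hv hθ
  refine ⟨p, ?_, hpq⟩
  rcases hp with rfl | rfl | rfl | rfl
  · rcases haU with rfl | rfl | rfl <;> simp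
  · rcases haU with rfl | rfl | rfl <;> simp
  · rcases hbU with rfl | rfl | rfl <;> simp
  · rcases hbU with rfl | rfl | rfl <;> simp

end
end
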